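/- arXiv:2006.04349 — 3 statements merged into one kernel-verified Lean document; each statement's English description precedes it below -/
import Mathlib

section
/- Let Ω be a Polish space, 𝓕 ⊆ F(Ω,ℝ), and P a Borel probability measure on Ω. Then for every h ∈ F(Ω,ℝ) and every ε > 0, sup_{Q ∈ B_{ε,𝓕}(P)} ∫_Ω h dQ ≤ ∫_Ω h dP + ε · inf_{b ∈ ℝ} Θ_𝓕(h − b), where h − b denotes the function ω ↦ h(ω) − b. -/
open MeasureTheory Set Pointwise
open scoped ENNReal NNReal

noncomputable section

/-- `F(Ω,ℝ)`: the set of bounded measurable functions `Ω → ℝ`. -/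
def Fbm (Ω : Type*) [MeasurableSpace Ω] : Set (Ω → ℝ) :=
  {h | Measurable h ∧ ∃ C : ℝ, ∀ ω, |h ω| ≤ C}

/-- Closed convex hull of a set of functions with respect to the topology of
uniform convergence. -/
def cchull {Ω : Type*} (𝓕 : Set (Ω → ℝ)) : Set (Ω → ℝ) :=
  {h | ∀ δ : ℝ, 0 < δ → ∃ g ∈ convexHull ℝ 𝓕, ∀ ω, |h ω - g ω| ≤ δ}

/-- `Θ_𝓕(h) = inf {λ > 0 : h ∈ λ · cl (co 𝓕)}`, valued in `[0,∞]` (inf over the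
empty set is `⊤`). -/
def theta {Ω : Type*} (𝓕 : Set (Ω → ℝ)) (h : Ω → ℝ) : EReal :=
  sInf ((fun l : ℝ => (l : EReal)) '' {l : ℝ | 0 < l ∧ h ∈ l • cchull 𝓕})

/-- The Integral Probability Metric `d_𝓕(P,Q) = sup_{g ∈ 𝓕} (∫ g dP - ∫ g dQ)`. -/
def ipm {Ω : Type*} [MeasurableSpace Ω] (𝓕 : Set (Ω → ℝ)) (P Q : Measure Ω) : EReal :=
  ⨆ g ∈ 𝓕, ((∫ ω, g ω ∂P - ∫ ω, g ω ∂Q : ℝ) : EReal)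

/-- The uncertainty ball `B_{ε,𝓕}(P) = {Q probability measure : d_𝓕(Q,P) ≤ ε}`. -/
def uball {Ω : Type*} [MeasurableSpace Ω] (𝓕 : Set (Ω → ℝ)) (ε : ℝ) (P : Measure Ω) :
    Set (Measure Ω) :=
  {Q | IsProbabilityMeasure Q ∧ ipm 𝓕 Q P ≤ (ε : EReal)}

/-- `J_P(h) = sup_{ν probability measure} ∫ h dν - ∫ h dP`. -/
def Jpen {Ω : Type*} [MeasurableSpace Ω] (P : Measure Ω) (h : Ω → ℝ) : EReal :=
  (⨆ ν : Measure Ω, ⨆ _ : IsProbabilityMeasure ν, ((∫ ω, h ω ∂ν : ℝ) : EReal))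
    - ((∫ ω, h ω ∂P : ℝ) : EReal)

/-- The `𝓕`-penalty `Λ_{𝓕,ε} = J_P □ (ε·Θ_𝓕)` (infimal convolution over `F(Ω,ℝ)`). -/
def Lam {Ω : Type*} [MeasurableSpace Ω] (𝓕 : Set (Ω → ℝ)) (P : Measure Ω) (ε : ℝ)
    (h : Ω → ℝ) : EReal :=
  ⨅ h' ∈ Fbm Ω, (Jpen P h' + (ε : EReal) * theta 𝓕 (h - h'))

theorem Fbm.integrable {Ω : Type*} [MeasurableSpace Ω] {h : Ω → ℝ} (hh : h ∈ Fbm Ω)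
    (μ : Measure Ω) [IsFiniteMeasure μ] : Integrable h μ := by
  obtain ⟨hm, C, hC⟩ := hh
  exact Integrable.of_bound hm.aestronglyMeasurable C (Filter.Eventually.of_forall hC)

theorem convex_Fbm (Ω : Type*) [MeasurableSpace Ω] : Convex ℝ (Fbm Ω) := by
  rintro f ⟨hf, C, hC⟩ g ⟨hg, D, hD⟩ a b ha hb -
  refine ⟨(hf.const_smul a).add (hg.const_smul b), a * C + b * D, fun ω => ?_⟩
  simp only [Pi.add_apply, Pi.smul_apply, smul_eq_mul]
  refine (abs_add_le _ _).trans ?_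
  rw [abs_mul, abs_mul, abs_of_nonneg ha, abs_of_nonneg hb]
  exact add_le_add (mul_le_mul_of_nonneg_left (hC ω) ha) (mul_le_mul_of_nonneg_left (hD ω) hb)

theorem convexHull_subset_integral_sub_le {Ω : Type*} [MeasurableSpace Ω] {𝓕 : Set (Ω → ℝ)}
    (h𝓕 : 𝓕 ⊆ Fbm Ω) {P Q : Measure Ω} [IsFiniteMeasure P] [IsFiniteMeasure Q] {ε : ℝ}
    (hε : ∀ g ∈ 𝓕, ∫ ω, g ω ∂Q - ∫ ω, g ω ∂P ≤ ε) :
    convexHull ℝ 𝓕 ⊆ {g | g ∈ Fbm Ω ∧ ∫ ω, g ω ∂Q - ∫ ω, g ω ∂P ≤ ε} := by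
  refine convexHull_min (fun g hg => ⟨h𝓕 hg, hε g hg⟩) ?_
  rintro f ⟨hf, hf'⟩ g ⟨hg, hg'⟩ a b ha hb hab
  refine ⟨convex_Fbm Ω hf hg ha hb hab, ?_⟩
  have key (μ : Measure Ω) [IsFiniteMeasure μ] :
      ∫ ω, (a • f + b • g) ω ∂μ = a * ∫ ω, f ω ∂μ + b * ∫ ω, g ω ∂μ := by
    simp only [Pi.add_apply, Pi.smul_apply, smul_eq_mul]
    rw [integral_add ((Fbm.integrable hf μ).const_mul a) ((Fbm.integrable hg μ).const_mul b),
      integral_const_mul, integral_const_mul]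
  rw [key, key]
  have h₁ := mul_le_mul_of_nonneg_left hf' ha
  have h₂ := mul_le_mul_of_nonneg_left hg' hb
  have h₃ : a * ε + b * ε = ε := by rw [← add_mul, hab, one_mul]
  linarith

theorem abs_integral_sub_integral_le {Ω : Type*} [MeasurableSpace Ω] {f g : Ω → ℝ}
    (hf : f ∈ Fbm Ω) (hg : g ∈ Fbm Ω) {δ : ℝ} (hfg : ∀ ω, |f ω - g ω| ≤ δ)
    (μ : Measure Ω) [IsProbabilityMeasure μ] :
    |∫ ω, f ω ∂μ - ∫ ω, g ω ∂μ| ≤ δ := by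
  rw [← integral_sub (Fbm.integrable hf μ) (Fbm.integrable hg μ), ← Real.norm_eq_abs]
  simpa using norm_integral_le_of_norm_le_const (μ := μ) (f := fun ω => f ω - g ω)
    (Filter.Eventually.of_forall hfg)

theorem integral_sub_le_of_mem_cchull {Ω : Type*} [MeasurableSpace Ω] {𝓕 : Set (Ω → ℝ)}
    (h𝓕 : 𝓕 ⊆ Fbm Ω) {P Q : Measure Ω} [IsProbabilityMeasure P] [IsProbabilityMeasure Q]
    {ε : ℝ} (hε : ∀ g ∈ 𝓕, ∫ ω, g ω ∂Q - ∫ ω, g ω ∂P ≤ ε) {f : Ω → ℝ} (hf : f ∈ Fbm Ω)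
    (hf' : f ∈ cchull 𝓕) : ∫ ω, f ω ∂Q - ∫ ω, f ω ∂P ≤ ε := by
  refine le_of_forall_pos_le_add fun δ hδ => ?_
  obtain ⟨g, hg, hfg⟩ := hf' (δ / 2) (half_pos hδ)
  obtain ⟨hgb, hgε⟩ := convexHull_subset_integral_sub_le h𝓕 hε hg
  have hQ := abs_le.1 (abs_integral_sub_integral_le hf hgb hfg Q)
  have hP := abs_le.1 (abs_integral_sub_integral_le hf hgb hfg P)
  linarith [hQ.2, hP.1]

theorem stmt1 {Ω : Type*} [TopologicalSpace Ω] [PolishSpace Ω] [MeasurableSpace Ω] [BorelSpace Ω]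
    (𝓕 : Set (Ω → ℝ)) (h𝓕 : 𝓕 ⊆ Fbm Ω) (P : Measure Ω) [IsProbabilityMeasure P]
    (h : Ω → ℝ) (hh : h ∈ Fbm Ω) (ε : ℝ) (hε : 0 < ε) :
    (⨆ Q ∈ uball 𝓕 ε P, ((∫ ω, h ω ∂Q : ℝ) : EReal))
      ≤ ((∫ ω, h ω ∂P : ℝ) : EReal)
        + (ε : EReal) * ⨅ b : ℝ, theta 𝓕 (fun ω => h ω - b) := by
  refine iSup₂_le fun Q hQ => ?_
  obtain ⟨hQp, hQ⟩ := hQ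
  have hQε : ∀ g ∈ 𝓕, ∫ ω, g ω ∂Q - ∫ ω, g ω ∂P ≤ ε := fun g hg =>
    EReal.coe_le_coe_iff.1 ((le_iSup₂_of_le g hg le_rfl).trans hQ)
  set d : ℝ := ∫ ω, h ω ∂Q - ∫ ω, h ω ∂P with hd
  have hle : ((d / ε : ℝ) : EReal) ≤ ⨅ b : ℝ, theta 𝓕 (fun ω => h ω - b) := by
    refine le_iInf fun b => le_sInf ?_
    rintro _ ⟨l, ⟨hl, f, hf, hfl⟩, rfl⟩
    have hfh : ∀ ω, l * f ω = h ω - b := fun ω => congrFun hfl ω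
    have hfeq : f = fun ω => l⁻¹ * (h ω - b) := by
      funext ω
      rw [← hfh, inv_mul_cancel_left₀ hl.ne']
    have hfb : f ∈ Fbm Ω := by
      obtain ⟨hm, C, hC⟩ := hh
      rw [hfeq]
      refine ⟨(hm.sub_const b).const_mul _, |l⁻¹| * (C + |b|), fun ω => ?_⟩
      rw [abs_mul]
      gcongr
      exact (abs_sub _ _).trans (by gcongr; exact hC ω)
    have key (μ : Measure Ω) [IsProbabilityMeasure μ] :
        l * ∫ ω, f ω ∂μ = ∫ ω, h ω ∂μ - b := by
      rw [← integral_const_mul]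
      simp only [hfh]
      rw [integral_sub (Fbm.integrable hh μ) (integrable_const b)]
      simp
    have h₁ := mul_le_mul_of_nonneg_left (integral_sub_le_of_mem_cchull h𝓕 hQε hfb hf) hl.le
    rw [mul_sub, key, key] at h₁
    refine EReal.coe_le_coe_iff.2 ((div_le_iff₀ hε).2 ?_)
    linarith
  calc ((∫ ω, h ω ∂Q : ℝ) : EReal)
      = ((∫ ω, h ω ∂P : ℝ) : EReal) + (ε : EReal) * ((d / ε : ℝ) : EReal) := by
        rw [← EReal.coe_mul, ← EReal.coe_add, mul_div_cancel₀ _ hε.ne', hd]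
        simp
    _ ≤ _ := by
        gcongr
end
end

section
/- Let 𝓕 ⊆ F(Ω,ℝ), P a Borel probability measure on Ω, ε > 0, and h ∈ F(Ω,ℝ). Then inf_{λ ≥ 0} [ (R_{λ𝓕} □ σ)(h) + λ·ε ] = ∫_Ω h dP + (J_P □ ε·Θ_𝓕)(h), where R_{λ𝓕}(g) = ∫_Ω g dP + ∞·[g ∉ λ·cl(co 𝓕)] and σ(g) = sup over Borel probability measures ν of ∫_Ω g dν. -/
open MeasureTheory Set Pointwise
open scoped ENNReal NNReal

noncomputable section

open scoped Classical in
/-- `R_{λ𝓕}(g) = ∫ g dP` if `g ∈ λ·cl(co 𝓕)`, and `+∞` otherwise. -/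
def Rlam {Ω : Type*} [MeasurableSpace Ω] (𝓕 : Set (Ω → ℝ)) (P : Measure Ω) (l : ℝ)
    (g : Ω → ℝ) : EReal :=
  if g ∈ l • cchull 𝓕 then ((∫ ω, g ω ∂P : ℝ) : EReal) else ⊤

/-- `σ(g) = sup_{ν probability measure} ∫ g dν`, the support function of `𝒫(Ω)`. -/
def sigmaP {Ω : Type*} [MeasurableSpace Ω] (g : Ω → ℝ) : EReal :=
  ⨆ ν : Measure Ω, ⨆ _ : IsProbabilityMeasure ν, ((∫ ω, g ω ∂ν : ℝ) : EReal)

lemma integrable_of_mem_Fbm {Ω : Type*} [MeasurableSpace Ω] {g : Ω → ℝ} (hg : g ∈ Fbm Ω)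
    (μ : Measure Ω) [IsProbabilityMeasure μ] : Integrable g μ := by
  obtain ⟨hm, C, hC⟩ := hg
  exact Integrable.of_bound hm.aestronglyMeasurable C (ae_of_all _ hC)

lemma sub_mem_Fbm {Ω : Type*} [MeasurableSpace Ω] {f g : Ω → ℝ} (hf : f ∈ Fbm Ω)
    (hg : g ∈ Fbm Ω) : f - g ∈ Fbm Ω := by
  obtain ⟨hfm, C, hC⟩ := hf
  obtain ⟨hgm, D, hD⟩ := hg
  exact ⟨hfm.sub hgm, C + D, fun ω => (abs_sub _ _).trans (add_le_add (hC ω) (hD ω))⟩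

lemma smul_mem_Fbm {Ω : Type*} [MeasurableSpace Ω] {f : Ω → ℝ} (hf : f ∈ Fbm Ω) (c : ℝ) :
    c • f ∈ Fbm Ω := by
  obtain ⟨hfm, C, hC⟩ := hf
  refine ⟨hfm.const_smul c, |c| * C, fun ω => ?_⟩
  rw [Pi.smul_apply, smul_eq_mul, abs_mul]
  exact mul_le_mul_of_nonneg_left (hC ω) (abs_nonneg c)

lemma integral_le_of_forall_le {Ω : Type*} [MeasurableSpace Ω] {g : Ω → ℝ} (hg : g ∈ Fbm Ω)
    (μ : Measure Ω) [IsProbabilityMeasure μ] {C : ℝ} (hC : ∀ ω, g ω ≤ C) :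
    ∫ ω, g ω ∂μ ≤ C := by
  simpa using integral_mono (integrable_of_mem_Fbm hg μ) (integrable_const C) hC

lemma integral_le_sigmaP {Ω : Type*} [MeasurableSpace Ω] (g : Ω → ℝ) (μ : Measure Ω)
    [hμ : IsProbabilityMeasure μ] : ((∫ ω, g ω ∂μ : ℝ) : EReal) ≤ sigmaP g :=
  le_iSup₂_of_le μ hμ le_rfl

lemma exists_sigmaP_eq_coe {Ω : Type*} [MeasurableSpace Ω] {g : Ω → ℝ} (hg : g ∈ Fbm Ω)
    (μ : Measure Ω) [IsProbabilityMeasure μ] : ∃ s : ℝ, sigmaP g = s := by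
  obtain ⟨C, hC⟩ := hg.2
  have hle : sigmaP g ≤ (C : EReal) := iSup₂_le fun ν _ =>
    EReal.coe_le_coe_iff.2 (integral_le_of_forall_le hg ν fun ω => (abs_le.1 (hC ω)).2)
  refine ⟨(sigmaP g).toReal, (EReal.coe_toReal ?_ ?_).symm⟩
  · exact (hle.trans_lt (EReal.coe_lt_top C)).ne
  · exact ((EReal.bot_lt_coe _).trans_le (integral_le_sigmaP g μ)).ne'

lemma sigmaP_le_add_of_forall_le_add {Ω : Type*} [MeasurableSpace Ω] {f g : Ω → ℝ}
    (hf : f ∈ Fbm Ω) (hg : g ∈ Fbm Ω) {C : ℝ} (hC : ∀ ω, f ω ≤ g ω + C) :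
    sigmaP f ≤ sigmaP g + (C : EReal) := by
  refine iSup₂_le fun ν _ => ?_
  have hle : ∫ ω, f ω ∂ν ≤ ∫ ω, g ω ∂ν + C := by
    have hsub := integral_le_of_forall_le (sub_mem_Fbm hf hg) ν (C := C)
      fun ω => sub_le_iff_le_add'.2 (hC ω)
    simp only [Pi.sub_apply] at hsub
    rw [integral_sub (integrable_of_mem_Fbm hf ν) (integrable_of_mem_Fbm hg ν)] at hsub
    linarith
  calc ((∫ ω, f ω ∂ν : ℝ) : EReal) ≤ ((∫ ω, g ω ∂ν + C : ℝ) : EReal) :=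
        EReal.coe_le_coe_iff.2 hle
    _ = ((∫ ω, g ω ∂ν : ℝ) : EReal) + C := EReal.coe_add _ _
    _ ≤ _ := by gcongr; exact integral_le_sigmaP g ν

lemma subset_cchull {Ω : Type*} (𝓕 : Set (Ω → ℝ)) : 𝓕 ⊆ cchull 𝓕 := fun f hf δ hδ =>
  ⟨f, subset_convexHull ℝ 𝓕 hf, fun ω => by simpa using hδ.le⟩

lemma nonempty_of_cchull_nonempty {Ω : Type*} {𝓕 : Set (Ω → ℝ)} (h : (cchull 𝓕).Nonempty) :
    𝓕.Nonempty := by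
  obtain ⟨f, hf⟩ := h
  obtain ⟨g, hg, -⟩ := hf 1 one_pos
  exact convexHull_nonempty_iff.1 ⟨g, hg⟩

lemma le_coe_add_iff {x y : EReal} {c : ℝ} : x ≤ (c : EReal) + y ↔ x - c ≤ y := by
  rw [add_comm]
  exact (EReal.sub_le_iff_le_add (Or.inl (EReal.coe_ne_bot c))
    (Or.inl (EReal.coe_ne_top c))).symm

lemma le_coe_mul_theta {Ω : Type*} {𝓕 : Set (Ω → ℝ)} {g : Ω → ℝ} {ε : ℝ} (hε : 0 < ε)
    {x : EReal} (hx : ∀ l : ℝ, 0 < l → g ∈ l • cchull 𝓕 → x ≤ ((ε * l : ℝ) : EReal)) :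
    x ≤ (ε : EReal) * theta 𝓕 g := by
  have hε' : (0 : EReal) < ε := EReal.coe_pos.2 hε
  rw [← EReal.div_le_iff_le_mul hε' (EReal.coe_ne_top ε)]
  refine le_sInf ?_
  rintro _ ⟨l, ⟨hl, hmem⟩, rfl⟩
  rw [EReal.div_le_iff_le_mul hε' (EReal.coe_ne_top ε), ← EReal.coe_mul]
  exact hx l hl hmem

lemma integral_add_Lam_le {Ω : Type*} [MeasurableSpace Ω] {𝓕 : Set (Ω → ℝ)} (P : Measure Ω)
    [IsProbabilityMeasure P] {ε : ℝ} (hε : 0 < ε) {h g : Ω → ℝ} (hh : h ∈ Fbm Ω)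
    (hg : g ∈ Fbm Ω) {l : ℝ} (hl : 0 < l) (hmem : g ∈ l • cchull 𝓕) :
    ((∫ ω, h ω ∂P : ℝ) : EReal) + Lam 𝓕 P ε h
      ≤ ((∫ ω, g ω ∂P + l * ε : ℝ) : EReal) + sigmaP (h - g) := by
  obtain ⟨s, hs⟩ := exists_sigmaP_eq_coe (sub_mem_Fbm hh hg) P
  have htheta : theta 𝓕 (h - (h - g)) ≤ (l : EReal) := by
    rw [sub_sub_cancel]
    exact sInf_le ⟨l, ⟨hl, hmem⟩, rfl⟩
  have hJ : Jpen P (h - g) = ((s - (∫ ω, h ω ∂P - ∫ ω, g ω ∂P) : ℝ) : EReal) := by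
    change sigmaP (h - g) - _ = _
    simp only [Pi.sub_apply]
    rw [hs, integral_sub (integrable_of_mem_Fbm hh P) (integrable_of_mem_Fbm hg P),
      EReal.coe_sub s]
  have hLam : Lam 𝓕 P ε h
      ≤ ((s - (∫ ω, h ω ∂P - ∫ ω, g ω ∂P) : ℝ) : EReal) + (ε : EReal) * (l : EReal) := by
    rw [← hJ]
    exact (iInf₂_le (h - g) (sub_mem_Fbm hh hg)).trans
      (add_le_add le_rfl (mul_le_mul_of_nonneg_left htheta (EReal.coe_nonneg.2 hε.le)))
  refine (add_le_add le_rfl hLam).trans ?_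
  rw [hs]
  norm_cast
  linarith

lemma integral_add_Lam_le_sigmaP {Ω : Type*} [MeasurableSpace Ω] {𝓕 : Set (Ω → ℝ)}
    (h𝓕 : 𝓕 ⊆ Fbm Ω) (hne : 𝓕.Nonempty) (P : Measure Ω) [IsProbabilityMeasure P] {ε : ℝ}
    (hε : 0 < ε) {h : Ω → ℝ} (hh : h ∈ Fbm Ω) :
    ((∫ ω, h ω ∂P : ℝ) : EReal) + Lam 𝓕 P ε h ≤ sigmaP h := by
  obtain ⟨f, hf⟩ := hne
  obtain ⟨C, hC⟩ := (h𝓕 hf).2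
  obtain ⟨s, hs⟩ := exists_sigmaP_eq_coe hh P
  have hbound (t : ℝ) (ht : 0 < t) : ((∫ ω, h ω ∂P : ℝ) : EReal) + Lam 𝓕 P ε h
      ≤ ((s + t * (2 * |C| + ε) : ℝ) : EReal) := by
    have hle (ω : Ω) : |f ω| ≤ |C| := (hC ω).trans (le_abs_self C)
    have hint := integral_le_of_forall_le (h𝓕 hf) P fun ω => (abs_le.1 (hle ω)).2
    have hsig := sigmaP_le_add_of_forall_le_add
      (sub_mem_Fbm hh (smul_mem_Fbm (h𝓕 hf) t)) hh (C := t * |C|)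
      fun ω => by
        have := mul_le_mul_of_nonneg_left (abs_le.1 (hle ω)).1 ht.le
        simp only [Pi.sub_apply, Pi.smul_apply, smul_eq_mul]
        linarith
    refine (integral_add_Lam_le P hε hh (smul_mem_Fbm (h𝓕 hf) t) ht
      (smul_mem_smul_set (subset_cchull 𝓕 hf))).trans ?_
    refine (add_le_add le_rfl hsig).trans ?_
    rw [hs]
    norm_cast
    simp only [Pi.smul_apply, smul_eq_mul, integral_const_mul]
    nlinarith
  rw [← EReal.le_of_forall_lt_iff_le]
  intro z hz
  rw [hs, EReal.coe_lt_coe_iff] at hz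
  have hK : 0 < 2 * |C| + ε := by positivity
  have := hbound ((z - s) / (2 * |C| + ε)) (div_pos (sub_pos.2 hz) hK)
  rwa [div_mul_cancel₀ _ hK.ne', add_sub_cancel] at this

theorem stmt13 {Ω : Type*} [TopologicalSpace Ω] [PolishSpace Ω] [MeasurableSpace Ω] [BorelSpace Ω]
    (𝓕 : Set (Ω → ℝ)) (h𝓕 : 𝓕 ⊆ Fbm Ω) (P : Measure Ω) [IsProbabilityMeasure P]
    (ε : ℝ) (hε : 0 < ε) (h : Ω → ℝ) (hh : h ∈ Fbm Ω) :
    (⨅ l : ℝ, ⨅ _ : 0 ≤ l,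
        ((⨅ h' ∈ Fbm Ω, (Rlam 𝓕 P l h' + sigmaP (h - h'))) + ((l * ε : ℝ) : EReal)))
      = ((∫ ω, h ω ∂P : ℝ) : EReal) + Lam 𝓕 P ε h := by
  apply le_antisymm
  · refine le_coe_add_iff.2 (le_iInf₂ fun h' hh' => ?_)
    have hg := sub_mem_Fbm hh hh'
    obtain ⟨s, hs⟩ := exists_sigmaP_eq_coe hh' P
    have hJ : Jpen P h' = ((s - ∫ ω, h' ω ∂P : ℝ) : EReal) := by
      change sigmaP h' - _ = _
      rw [hs, EReal.coe_sub]
    rw [hJ, ← le_coe_add_iff, ← add_assoc, ← EReal.coe_add, le_coe_add_iff]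
    refine le_coe_mul_theta hε fun l hl hmem => le_coe_add_iff.1 ?_
    refine (iInf₂_le l hl.le).trans ?_
    refine (add_le_add (iInf₂_le (h - h') hg) le_rfl).trans ?_
    rw [Rlam, if_pos hmem, sub_sub_cancel, hs]
    simp only [Pi.sub_apply]
    rw [integral_sub (integrable_of_mem_Fbm hh P) (integrable_of_mem_Fbm hh' P)]
    norm_cast
    linarith
  · refine le_iInf₂ fun l hl => ?_
    rw [add_comm (⨅ h' ∈ Fbm Ω, _), le_coe_add_iff]
    refine le_iInf₂ fun g hg => le_coe_add_iff.1 ?_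
    obtain ⟨s, hs⟩ := exists_sigmaP_eq_coe (sub_mem_Fbm hh hg) P
    by_cases hmem : g ∈ l • cchull 𝓕
    · rw [Rlam, if_pos hmem]
      rcases hl.eq_or_lt with rfl | hl
      · obtain ⟨f, hf, hfg⟩ := hmem
        have hg0 : g = 0 := by simpa using hfg.symm
        simpa [hg0] using
          integral_add_Lam_le_sigmaP h𝓕 (nonempty_of_cchull_nonempty ⟨f, hf⟩) P hε hh
      · rw [← add_assoc, ← EReal.coe_add, add_comm (l * ε)]
        exact integral_add_Lam_le P hε hh hg hl hmem
    · rw [Rlam, if_neg hmem, hs, EReal.top_add_coe, EReal.coe_add_top]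
      exact le_top
end
end

section
/- Let Ω be a Polish space, let 𝓕 = {h ∈ F(Ω,ℝ) : ‖h‖_∞ ≤ 1} be the sup-norm unit ball (so that d_𝓕 is the Total Variation IPM), and let P be a Borel probability measure on Ω. Then Θ_𝓕(h) = ‖h‖_∞ for every h ∈ F(Ω,ℝ), and consequently for every ε > 0, Λ_{𝓕,ε}(h) ≤ ε · inf_{b ∈ ℝ} ‖h − b‖_∞, so that sup_{Q ∈ B_{ε,𝓕}(P)} ∫_Ω h dQ ≤ ∫_Ω h dP + ε · inf_{b ∈ ℝ} ‖h − b‖_∞. -/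
open MeasureTheory Set Pointwise
open scoped ENNReal NNReal

noncomputable section

/-- The sup norm `‖g‖_∞ = sup_ω |g(ω)|` (as a real supremum; honest on bounded
functions). -/
def supnorm {Ω : Type*} (g : Ω → ℝ) : ℝ := ⨆ ω, |g ω|

theorem abs_le_supnorm {Ω : Type*} [MeasurableSpace Ω] {h : Ω → ℝ} (hh : h ∈ Fbm Ω) (ω : Ω) :
    |h ω| ≤ supnorm h := by
  obtain ⟨-, C, hC⟩ := hh
  exact le_ciSup (f := fun ω => |h ω|) ⟨C, by rintro _ ⟨ω, rfl⟩; exact hC ω⟩ ω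

theorem supnorm_nonneg {Ω : Type*} (h : Ω → ℝ) : 0 ≤ supnorm h :=
  Real.iSup_nonneg fun _ => abs_nonneg _

theorem const_mem_Fbm {Ω : Type*} [MeasurableSpace Ω] (b : ℝ) : (fun _ => b) ∈ Fbm Ω :=
  ⟨measurable_const, |b|, fun _ => le_rfl⟩

theorem sub_const_mem_Fbm {Ω : Type*} [MeasurableSpace Ω] {h : Ω → ℝ} (hh : h ∈ Fbm Ω) (b : ℝ) :
    (fun ω => h ω - b) ∈ Fbm Ω := by
  obtain ⟨hm, C, hC⟩ := hh
  exact ⟨hm.sub_const b, C + |b|, fun ω => (abs_sub _ _).trans (by gcongr; exact hC ω)⟩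

theorem integrable_of_mem_Fbm_s18 {Ω : Type*} [MeasurableSpace Ω] {h : Ω → ℝ} (hh : h ∈ Fbm Ω)
    (Q : Measure Ω) [IsFiniteMeasure Q] : Integrable h Q := by
  obtain ⟨hm, C, hC⟩ := hh
  exact Integrable.of_bound hm.aestronglyMeasurable C (ae_of_all _ hC)

/-- Rescaling a bounded measurable function by any positive bound puts it in the unit ball. -/
theorem inv_smul_mem_unitBall {Ω : Type*} [MeasurableSpace Ω] [Nonempty Ω] {h : Ω → ℝ}
    (hh : h ∈ Fbm Ω) {l : ℝ} (hl : 0 < l) (hle : supnorm h ≤ l) :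
    l⁻¹ • h ∈ {g : Ω → ℝ | g ∈ Fbm Ω ∧ supnorm g ≤ 1} := by
  have hb (ω : Ω) : |(l⁻¹ • h) ω| ≤ 1 := by
    rw [Pi.smul_apply, smul_eq_mul, abs_mul, abs_of_pos (inv_pos.2 hl), inv_mul_le_iff₀ hl, mul_one]
    exact (abs_le_supnorm hh ω).trans hle
  exact ⟨⟨hh.1.const_smul _, 1, hb⟩, ciSup_le hb⟩

theorem abs_le_one_of_mem_cchull {Ω : Type*} [MeasurableSpace Ω] {g : Ω → ℝ}
    (hg : g ∈ cchull {g : Ω → ℝ | g ∈ Fbm Ω ∧ supnorm g ≤ 1}) (ω : Ω) : |g ω| ≤ 1 := by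
  refine le_of_forall_pos_le_add fun δ hδ => ?_
  obtain ⟨k, hk, hgk⟩ := hg δ hδ
  have hsub : convexHull ℝ {g : Ω → ℝ | g ∈ Fbm Ω ∧ supnorm g ≤ 1} ⊆
      {g : Ω → ℝ | g ω ∈ Icc (-1 : ℝ) 1} := by
    refine convexHull_min (fun f hf => abs_le.1 ((abs_le_supnorm hf.1 ω).trans hf.2)) ?_
    exact (convex_Icc (-1 : ℝ) 1).linear_preimage (LinearMap.proj (R := ℝ) (φ := fun _ : Ω => ℝ) ω)
  have h1 : |k ω| ≤ 1 := abs_le.2 (hsub hk)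
  have h2 := abs_sub_abs_le_abs_sub (g ω) (k ω)
  linarith [hgk ω]

theorem theta_unitBall {Ω : Type*} [MeasurableSpace Ω] [Nonempty Ω] {h : Ω → ℝ}
    (hh : h ∈ Fbm Ω) :
    theta {g : Ω → ℝ | g ∈ Fbm Ω ∧ supnorm g ≤ 1} h = ((supnorm h : ℝ) : EReal) := by
  apply le_antisymm
  · refine EReal.le_of_forall_lt_iff_le.1 fun l hl => ?_
    have hl' : supnorm h < l := EReal.coe_lt_coe_iff.1 hl
    have hpos : 0 < l := (supnorm_nonneg h).trans_lt hl'
    refine sInf_le ⟨l, ⟨hpos, l⁻¹ • h, fun δ hδ => ⟨l⁻¹ • h, ?_, fun ω => ?_⟩, ?_⟩, rfl⟩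
    · exact subset_convexHull ℝ _ (inv_smul_mem_unitBall hh hpos hl'.le)
    · simpa using hδ.le
    · exact smul_inv_smul₀ hpos.ne' h
  · refine le_sInf ?_
    rintro _ ⟨l, ⟨hl, g, hg, rfl⟩, rfl⟩
    refine EReal.coe_le_coe_iff.2 (ciSup_le fun ω => ?_)
    simp only [Pi.smul_apply, smul_eq_mul, abs_mul, abs_of_pos hl]
    exact mul_le_of_le_one_right hl.le (abs_le_one_of_mem_cchull hg ω)

theorem Jpen_const_le {Ω : Type*} [MeasurableSpace Ω] (P : Measure Ω) [IsProbabilityMeasure P]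
    (b : ℝ) : Jpen P (fun _ => b) ≤ 0 := by
  rw [Jpen, EReal.sub_nonpos]
  exact iSup₂_le fun ν _ => by simp

theorem le_coe_mul_iInf {ι : Sort*} {c : EReal} {ε : ℝ} (hε : 0 < ε) {f : ι → EReal}
    (hc : ∀ i, c ≤ ε * f i) : c ≤ ε * ⨅ i, f i := by
  have hε' : (0 : EReal) < ε := EReal.coe_pos.2 hε
  have key (x : EReal) : c ≤ ε * x ↔ c / ε ≤ x :=
    (EReal.div_le_iff_le_mul hε' (EReal.coe_ne_top ε)).symm
  exact (key _).2 (le_iInf fun i => (key _).1 (hc i))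

/-- A total variation bound controls the difference of expectations by the oscillation around
any constant. -/
theorem integral_sub_integral_le {Ω : Type*} [MeasurableSpace Ω] [Nonempty Ω]
    {P Q : Measure Ω} [IsProbabilityMeasure P] {ε : ℝ} {h : Ω → ℝ} (hh : h ∈ Fbm Ω)
    (hQ : Q ∈ uball {g : Ω → ℝ | g ∈ Fbm Ω ∧ supnorm g ≤ 1} ε P) (b : ℝ) :
    ∫ ω, h ω ∂Q - ∫ ω, h ω ∂P ≤ ε * supnorm (fun ω => h ω - b) := by
  obtain ⟨hQp, hQ⟩ := hQ
  have hk := sub_const_mem_Fbm hh b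
  have hdiff : ∫ ω, h ω ∂Q - ∫ ω, h ω ∂P = ∫ ω, (h ω - b) ∂Q - ∫ ω, (h ω - b) ∂P := by
    rw [integral_sub (integrable_of_mem_Fbm_s18 hh Q) (integrable_const b),
      integral_sub (integrable_of_mem_Fbm_s18 hh P) (integrable_const b)]
    simp
  rw [hdiff]
  rcases (supnorm_nonneg fun ω => h ω - b).eq_or_lt with hs | hs
  · have h0 (ω : Ω) : h ω - b = 0 :=
      abs_nonpos_iff.1 ((abs_le_supnorm hk ω).trans hs.symm.le)
    rw [← hs]
    simp [h0]
  · have hg := (le_iSup₂ (f := fun (g : Ω → ℝ) (_ : g ∈ {g : Ω → ℝ | g ∈ Fbm Ω ∧ supnorm g ≤ 1}) =>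
      ((∫ ω, g ω ∂Q - ∫ ω, g ω ∂P : ℝ) : EReal)) _ (inv_smul_mem_unitBall hk hs le_rfl)).trans hQ
    have hg' := EReal.coe_le_coe_iff.1 hg
    simp only [Pi.smul_apply, smul_eq_mul, integral_const_mul] at hg'
    rwa [← mul_sub, inv_mul_le_iff₀ hs, mul_comm] at hg'

theorem stmt18 {Ω : Type*} [TopologicalSpace Ω] [PolishSpace Ω] [MeasurableSpace Ω] [BorelSpace Ω]
    (P : Measure Ω) [IsProbabilityMeasure P] :
    (∀ h ∈ Fbm Ω,
        theta {g : Ω → ℝ | g ∈ Fbm Ω ∧ supnorm g ≤ 1} h = ((supnorm h : ℝ) : EReal)) ∧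
    (∀ h ∈ Fbm Ω, ∀ ε : ℝ, 0 < ε →
        Lam {g : Ω → ℝ | g ∈ Fbm Ω ∧ supnorm g ≤ 1} P ε h
          ≤ (ε : EReal) * ⨅ b : ℝ, ((supnorm (fun ω => h ω - b) : ℝ) : EReal)) ∧
    (∀ h ∈ Fbm Ω, ∀ ε : ℝ, 0 < ε →
        (⨆ Q ∈ uball {g : Ω → ℝ | g ∈ Fbm Ω ∧ supnorm g ≤ 1} ε P,
            ((∫ ω, h ω ∂Q : ℝ) : EReal))
          ≤ ((∫ ω, h ω ∂P : ℝ) : EReal)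
            + (ε : EReal) * ⨅ b : ℝ, ((supnorm (fun ω => h ω - b) : ℝ) : EReal)) := by
  have : Nonempty Ω := nonempty_of_isProbabilityMeasure P
  refine ⟨fun h hh => theta_unitBall hh, fun h hh ε hε => le_coe_mul_iInf hε fun b => ?_,
    fun h hh ε hε => iSup₂_le fun Q hQ => ?_⟩
  · refine (iInf₂_le _ (const_mem_Fbm b)).trans ?_
    have hθ := theta_unitBall (sub_const_mem_Fbm hh b)
    calc _ ≤ (0 : EReal) + _ := add_le_add (Jpen_const_le P b) le_rfl
      _ = _ := by rw [zero_add, ← hθ]; rfl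
  · have key : ((∫ ω, h ω ∂Q - ∫ ω, h ω ∂P : ℝ) : EReal) ≤
        (ε : EReal) * ⨅ b : ℝ, ((supnorm (fun ω => h ω - b) : ℝ) : EReal) :=
      le_coe_mul_iInf hε fun b => by
        exact_mod_cast integral_sub_integral_le hh hQ b
    calc ((∫ ω, h ω ∂Q : ℝ) : EReal)
        = ((∫ ω, h ω ∂P : ℝ) : EReal) + ((∫ ω, h ω ∂Q - ∫ ω, h ω ∂P : ℝ) : EReal) := by
          rw [← EReal.coe_add, add_sub_cancel]
      _ ≤ _ := add_le_add le_rfl key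
end
end
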